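/- Let C be an abelian category with exact countable products and B ⊆ C a full subcategory that is cogenerating (every object of C embeds into an object of B) and closed under countable products. Then every cochain complex C^• in C admits a quasi-isomorphism C^• → B^• into a complex B^• with all terms in B. -/

import Mathlib

open CategoryTheory CategoryTheory.Limits

universe v u

/-- A choice, for every cochain complex `K` and all `a + 1 = b`, of an object `obj K b` and a
morphism `K.X a ⟶ obj K b` whose kernel is the object of coboundaries. -/
structure CoboundaryDetector (C : Type u) [Category.{v} C] [Abelian C] where
  /-- the targets of the detecting morphisms -/
  obj : CochainComplex C ℤ → ℤ → C
  /-- the detecting morphisms, zero unless `a + 1 = b` -/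
  φ (K : CochainComplex C ℤ) (a b : ℤ) : K.X a ⟶ obj K b
  shape (K : CochainComplex C ℤ) (a b : ℤ) (h : ¬ a + 1 = b) : φ K a b = 0
  d_comp_φ (K : CochainComplex C ℤ) (a b c : ℤ) : K.d a b ≫ φ K b c = 0
  exists_lift (K : CochainComplex C ℤ) (a b c : ℤ) (hab : a + 1 = b) (hbc : b + 1 = c)
    {T : C} (x : T ⟶ K.X b) (hx : x ≫ φ K b c = 0) :
    ∃ (T' : C) (π : T' ⟶ T) (_ : Epi π) (y : T' ⟶ K.X a), π ≫ x = y ≫ K.d a b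

section

variable {C : Type u} [Category.{v} C] [Abelian C]

/-- Embedding the cokernels of the differentials into objects of a cogenerating class detects
coboundaries. -/
theorem exists_coboundaryDetector (𝓑 : C → Prop)
    (hcogen : ∀ X : C, ∃ (B : C) (ι : X ⟶ B), 𝓑 B ∧ Mono ι) :
    ∃ D : CoboundaryDetector C, ∀ K n, 𝓑 (D.obj K n) := by
  choose B ι hB hι using hcogen
  refine ⟨{ obj K b := B (K.opcycles (b - 1))
            φ K a b := if h : a + 1 = b then
              K.pOpcycles a ≫ ι _ ≫ eqToHom (by subst h; simp) else 0
            shape K a b h := dif_neg h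
            d_comp_φ K a b c := ?_
            exists_lift K a b c hab hbc T x hx := ?_ }, fun K n => hB _⟩
  · split_ifs <;> simp
  · have hx' : x ≫ K.pOpcycles b = 0 := by
      rw [dif_pos hbc, ← Category.assoc, ← Category.assoc, comp_eqToHom_iff, zero_comp] at hx
      rwa [← cancel_mono (ι _), zero_comp]
    exact (K.comp_pOpcycles_eq_zero_iff_up_to_refinements x a (by simp; lia)).1 hx'

/-- Countably many epimorphisms onto `T` have a common refinement when countable products
are exact. -/
theorem exists_epi_common_refinement [HasCountableProducts C]
    (hprodexact : ∀ (X Y : ℕ → C) (f : ∀ n, X n ⟶ Y n),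
      (∀ n, Epi (f n)) → Epi (CategoryTheory.Limits.Pi.map f))
    {T : C} (S : ℕ → C) (π : ∀ j, S j ⟶ T) (hπ : ∀ j, Epi (π j)) :
    ∃ (T' : C) (ρ : T' ⟶ T) (_ : Epi ρ) (l : ∀ j, T' ⟶ S j), ∀ j, l j ≫ π j = ρ := by
  have := hprodexact S (fun _ => T) π hπ
  refine ⟨pullback (Limits.Pi.map π) (Pi.lift (fun _ => 𝟙 T)), pullback.snd _ _, inferInstance,
    fun j => pullback.fst _ _ ≫ Pi.π _ j, fun j => ?_⟩
  have := pullback.condition (f := Limits.Pi.map π) (g := Pi.lift (fun _ => 𝟙 T)) =≫ Pi.π _ j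
  simpa using this

namespace CoboundaryDetector

variable (D : CoboundaryDetector C) (K : CochainComplex C ℤ)

/-- The mapping fiber of `D.φ K`, viewed as a morphism of `K` to a complex with zero
differential. -/
noncomputable def fiber : CochainComplex C ℤ where
  X n := K.X n ⊞ D.obj K n
  d a b := biprod.fst ≫ biprod.lift (K.d a b) (D.φ K a b)
  shape a b h := by
    ext <;> simp [K.shape a b h, D.shape K a b h]
  d_comp_d' a b c _ _ := by
    ext <;> simp [D.d_comp_φ]

/-- The tower of iterated fibers over `K`. -/
noncomputable def tower : ℕ → CochainComplex C ℤ
  | 0 => K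
  | j + 1 => D.fiber (tower j)

/-- The transition morphism of the tower, in degree `n`. -/
noncomputable def towerFst (j : ℕ) (n : ℤ) : (D.tower K (j + 1)).X n ⟶ (D.tower K j).X n :=
  (biprod.fst : (D.tower K j).X n ⊞ D.obj (D.tower K j) n ⟶ _)

/-- The projection to the kernel of the transition morphism of the tower, in degree `n`. -/
noncomputable def towerSnd (j : ℕ) (n : ℤ) :
    (D.tower K (j + 1)).X n ⟶ D.obj (D.tower K j) n :=
  (biprod.snd : (D.tower K j).X n ⊞ D.obj (D.tower K j) n ⟶ _)

variable {K} in
/-- The morphism to the next stage of the tower with given components. -/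
noncomputable def towerLift {j : ℕ} {n : ℤ} {T : C} (x : T ⟶ (D.tower K j).X n)
    (e : T ⟶ D.obj (D.tower K j) n) : T ⟶ (D.tower K (j + 1)).X n :=
  (biprod.lift x e : T ⟶ (D.tower K j).X n ⊞ D.obj (D.tower K j) n)

section

variable {j : ℕ} {n : ℤ} {T : C}

lemma towerLift_fst (x : T ⟶ (D.tower K j).X n) (e : T ⟶ D.obj (D.tower K j) n) :
    D.towerLift x e ≫ D.towerFst K j n = x :=
  biprod.lift_fst _ _

lemma towerLift_snd (x : T ⟶ (D.tower K j).X n) (e : T ⟶ D.obj (D.tower K j) n) :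
    D.towerLift x e ≫ D.towerSnd K j n = e :=
  biprod.lift_snd _ _

variable {D K} in
lemma tower_hom_ext {x y : T ⟶ (D.tower K (j + 1)).X n}
    (h₁ : x ≫ D.towerFst K j n = y ≫ D.towerFst K j n)
    (h₂ : x ≫ D.towerSnd K j n = y ≫ D.towerSnd K j n) : x = y :=
  biprod.hom_ext (X := (D.tower K j).X n) (Y := D.obj (D.tower K j) n) _ _ h₁ h₂

lemma tower_d_fst (j : ℕ) (a b : ℤ) :
    (D.tower K (j + 1)).d a b ≫ D.towerFst K j b =
      D.towerFst K j a ≫ (D.tower K j).d a b :=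
  (Category.assoc _ _ _).trans (congrArg (D.towerFst K j a ≫ ·) (biprod.lift_fst _ _))

lemma tower_d_snd (j : ℕ) (a b : ℤ) :
    (D.tower K (j + 1)).d a b ≫ D.towerSnd K j b =
      D.towerFst K j a ≫ D.φ (D.tower K j) a b :=
  (Category.assoc _ _ _).trans (congrArg (D.towerFst K j a ≫ ·) (biprod.lift_snd _ _))

end

section assemble

variable {K} {n : ℤ} {T : C}

/-- The compatible family of morphisms to the tower with given components. -/
noncomputable def assemble (x : T ⟶ K.X n) (e : ∀ j, T ⟶ D.obj (D.tower K j) n) :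
    ∀ j, T ⟶ (D.tower K j).X n
  | 0 => x
  | j + 1 => D.towerLift (assemble x e j) (e j)

lemma assemble_succ_fst (x : T ⟶ K.X n) (e : ∀ j, T ⟶ D.obj (D.tower K j) n) (j : ℕ) :
    D.assemble x e (j + 1) ≫ D.towerFst K j n = D.assemble x e j :=
  D.towerLift_fst _ _ _

lemma assemble_succ_snd (x : T ⟶ K.X n) (e : ∀ j, T ⟶ D.obj (D.tower K j) n) (j : ℕ) :
    D.assemble x e (j + 1) ≫ D.towerSnd K j n = e j :=
  D.towerLift_snd _ _ _

lemma eq_assemble {y : ∀ j, T ⟶ (D.tower K j).X n} {x : T ⟶ K.X n}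
    {e : ∀ j, T ⟶ D.obj (D.tower K j) n} (h₀ : y 0 = x)
    (h₁ : ∀ j, y (j + 1) ≫ D.towerFst K j n = y j)
    (h₂ : ∀ j, y (j + 1) ≫ D.towerSnd K j n = e j) (j : ℕ) : y j = D.assemble x e j := by
  induction j with
  | zero => exact h₀
  | succ j ih =>
    apply tower_hom_ext
    · rw [assemble_succ_fst, h₁, ih]
    · rw [assemble_succ_snd, h₂]

lemma comp_assemble {T' : C} (g : T' ⟶ T) (x : T ⟶ K.X n)
    (e : ∀ j, T ⟶ D.obj (D.tower K j) n) (j : ℕ) :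
    g ≫ D.assemble x e j = D.assemble (g ≫ x) (fun j => g ≫ e j) j :=
  D.eq_assemble (y := fun j => g ≫ D.assemble x e j) rfl
    (by simp [assemble_succ_fst]) (by simp [assemble_succ_snd]) j

lemma assemble_add (x x' : T ⟶ K.X n) (e e' : ∀ j, T ⟶ D.obj (D.tower K j) n) (j : ℕ) :
    D.assemble x e j + D.assemble x' e' j = D.assemble (x + x') (fun j => e j + e' j) j :=
  D.eq_assemble (y := fun j => D.assemble x e j + D.assemble x' e' j) rfl
    (by simp [assemble_succ_fst]) (by simp [assemble_succ_snd]) j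

lemma assemble_d (x : T ⟶ K.X n) (e : ∀ j, T ⟶ D.obj (D.tower K j) n) (m : ℤ) (j : ℕ) :
    D.assemble x e j ≫ (D.tower K j).d n m =
      D.assemble (x ≫ K.d n m) (fun j => D.assemble x e j ≫ D.φ (D.tower K j) n m) j :=
  D.eq_assemble (y := fun j => D.assemble x e j ≫ (D.tower K j).d n m) rfl
    (fun j => by
      rw [Category.assoc, tower_d_fst, ← Category.assoc, assemble_succ_fst])
    (fun j => by
      rw [Category.assoc, tower_d_snd, ← Category.assoc, assemble_succ_fst]) j

/-- The differential of an assembled family is annihilated by `φ`. -/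
lemma assemble_d_φ (x : T ⟶ K.X n) (e : ∀ j, T ⟶ D.obj (D.tower K j) n) (m k : ℤ) (j : ℕ) :
    D.assemble (x ≫ K.d n m) (fun j => D.assemble x e j ≫ D.φ (D.tower K j) n m) j ≫
      D.φ (D.tower K j) m k = 0 := by
  rw [← assemble_d, Category.assoc, d_comp_φ, comp_zero]

end assemble

variable [HasCountableProducts C]

/-- The differential of the resolution of `K`. -/
noncomputable def resolutionD (a b : ℤ) :
    (∏ᶜ fun j => D.obj (D.tower K j) (a + 1)) ⟶ ∏ᶜ fun j => D.obj (D.tower K j) (b + 1) :=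
  -Pi.lift fun j =>
    D.assemble (K := K) 0 (fun j => Pi.π _ j) j ≫ D.φ (D.tower K j) (a + 1) (b + 1)

lemma comp_resolutionD_π {a : ℤ} {T : C} (e : T ⟶ ∏ᶜ fun j => D.obj (D.tower K j) (a + 1))
    (b : ℤ) (j : ℕ) :
    (e ≫ D.resolutionD K a b) ≫ Pi.π _ j =
      -(D.assemble (K := K) 0 (fun j => e ≫ Pi.π _ j) j ≫
        D.φ (D.tower K j) (a + 1) (b + 1)) := by
  simp only [resolutionD, Category.assoc, Pi.lift_π, Preadditive.comp_neg, Preadditive.neg_comp]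
  rw [← Category.assoc, comp_assemble, comp_zero]

/-- The product total complex of the targets of the detecting morphisms of the tower. -/
noncomputable def resolution : CochainComplex C ℤ where
  X n := ∏ᶜ fun j => D.obj (D.tower K j) (n + 1)
  d a b := D.resolutionD K a b
  shape a b h := by
    have h' : ¬ a + 1 + 1 = b + 1 := by simpa using h
    refine Pi.hom_ext _ _ fun j => ?_
    simp [resolutionD, D.shape _ _ _ h']
  d_comp_d' a b c _ _ := by
    refine Pi.hom_ext _ _ fun j => ?_
    have h := D.assemble_d_φ (K := K) 0
      (fun j => Pi.π (fun j => D.obj (D.tower K j) (a + 1)) j) (b + 1) (c + 1) j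
    have h' := D.comp_resolutionD_π K (-D.resolutionD K a b) c j
    rw [zero_comp] at h
    rw [show D.assemble (K := K) 0 (fun j => (-D.resolutionD K a b) ≫ Pi.π _ j) j ≫
      D.φ (D.tower K j) (b + 1) (c + 1) = 0 by simpa [resolutionD] using h, neg_zero] at h'
    simpa using h'

/-- The components of the morphism from `K` to its resolution. -/
noncomputable def toResolutionF (n : ℤ) :
    K.X n ⟶ ∏ᶜ fun j => D.obj (D.tower K j) (n + 1) :=
  Pi.lift fun j => D.assemble (𝟙 (K.X n)) (fun _ => 0) j ≫ D.φ (D.tower K j) n (n + 1)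

lemma comp_toResolutionF_π {n : ℤ} {T : C} (x : T ⟶ K.X n) (j : ℕ) :
    (x ≫ D.toResolutionF K n) ≫ Pi.π _ j =
      D.assemble x (fun _ => 0) j ≫ D.φ (D.tower K j) n (n + 1) := by
  simp only [toResolutionF, Category.assoc, Pi.lift_π]
  rw [← Category.assoc, comp_assemble, Category.comp_id]
  simp only [comp_zero]

/-- The differential of the fiber of `K ⟶ D.resolution K`, described through the tower. -/
lemma toResolutionF_sub_resolutionD_π {z : ℤ} {T : C} (x : T ⟶ K.X (z + 1))
    (e : T ⟶ ∏ᶜ fun j => D.obj (D.tower K j) (z + 1)) (j : ℕ) :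
    (x ≫ D.toResolutionF K (z + 1) - e ≫ D.resolutionD K z (z + 1)) ≫ Pi.π _ j =
      D.assemble x (fun j => e ≫ Pi.π _ j) j ≫ D.φ (D.tower K j) (z + 1) (z + 1 + 1) := by
  rw [Preadditive.sub_comp, comp_resolutionD_π, comp_toResolutionF_π, sub_neg_eq_add,
    ← Preadditive.add_comp, assemble_add]
  simp only [zero_add, add_zero]

/-- The morphism from `K` to its resolution. -/
noncomputable def toResolution : K ⟶ D.resolution K where
  f n := D.toResolutionF K n
  comm' a b hab := by
    obtain rfl : a + 1 = b := hab
    refine Pi.hom_ext _ _ fun j => ?_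
    change (D.toResolutionF K a ≫ D.resolutionD K a (a + 1)) ≫
        Pi.π (fun j => D.obj (D.tower K j) (a + 1 + 1)) j =
      (K.d a (a + 1) ≫ D.toResolutionF K (a + 1)) ≫ Pi.π _ j
    have h := D.assemble_d_φ (𝟙 (K.X a)) (fun _ => 0) (a + 1) (a + 1 + 1) j
    have h' := D.toResolutionF_sub_resolutionD_π K (K.d a (a + 1)) (D.toResolutionF K a) j
    simp only [toResolutionF, Pi.lift_π] at h'
    rw [Category.id_comp] at h
    rw [h, Preadditive.sub_comp, sub_eq_zero] at h'
    exact h'.symm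

/-- The fiber of `D.toResolution K` is acyclic. -/
lemma toResolution_exact
    (hprodexact : ∀ (X Y : ℕ → C) (f : ∀ n, X n ⟶ Y n),
      (∀ n, Epi (f n)) → Epi (CategoryTheory.Limits.Pi.map f))
    {z : ℤ} {T : C} (x : T ⟶ K.X (z + 1 + 1)) (e : T ⟶ (D.resolution K).X (z + 1))
    (hxe : x ≫ (D.toResolution K).f (z + 1 + 1) =
      e ≫ (D.resolution K).d (z + 1) (z + 1 + 1)) :
    ∃ (T' : C) (π : T' ⟶ T) (_ : Epi π) (y : T' ⟶ K.X (z + 1))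
      (e' : T' ⟶ (D.resolution K).X z), π ≫ x = y ≫ K.d (z + 1) (z + 1 + 1) ∧
        π ≫ e = y ≫ (D.toResolution K).f (z + 1) - e' ≫ (D.resolution K).d z (z + 1) := by
  change T ⟶ ∏ᶜ fun j => D.obj (D.tower K j) (z + 1 + 1) at e
  change x ≫ D.toResolutionF K (z + 1 + 1) = e ≫ D.resolutionD K (z + 1) (z + 1 + 1) at hxe
  let c : ∀ j, T ⟶ (D.tower K j).X (z + 1 + 1) := D.assemble x (fun j => e ≫ Pi.π _ j)
  have hcφ : ∀ j, c j ≫ D.φ (D.tower K j) (z + 1 + 1) (z + 1 + 1 + 1) = 0 := fun j => by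
    rw [← toResolutionF_sub_resolutionD_π, hxe, sub_self, zero_comp]
  have hcp : ∀ j, c (j + 1) ≫ D.towerFst K j _ = c j := D.assemble_succ_fst _ _
  -- the stages of `c` are simultaneously coboundaries of some `y j`
  choose S ρ hρ y₀ hy₀ using fun j =>
    D.exists_lift (D.tower K j) (z + 1) (z + 1 + 1) (z + 1 + 1 + 1) rfl rfl (c j) (hcφ j)
  obtain ⟨T₁, π₁, _, l, hl⟩ := exists_epi_common_refinement hprodexact S ρ hρ
  let y : ∀ j, T₁ ⟶ (D.tower K j).X (z + 1) := fun j => l j ≫ y₀ j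
  have hy : ∀ j, y j ≫ (D.tower K j).d (z + 1) (z + 1 + 1) = π₁ ≫ c j := fun j => by
    rw [Category.assoc, ← hy₀, ← Category.assoc, hl]
  -- the defect of compatibility of the `y j` is, one stage lower, a family of coboundaries
  let w : ∀ j, T₁ ⟶ (D.tower K (j + 1)).X (z + 1) := fun j =>
    y (j + 2) ≫ D.towerFst K (j + 1) _ - y (j + 1)
  have hw : ∀ j, w j ≫ (D.tower K (j + 1)).d (z + 1) (z + 1 + 1) = 0 := fun j => by
    rw [Preadditive.sub_comp, Category.assoc, ← tower_d_fst, ← Category.assoc, hy, hy,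
      Category.assoc, hcp, sub_self]
  have hwφ : ∀ j, (w j ≫ D.towerFst K j _) ≫ D.φ (D.tower K j) (z + 1) (z + 1 + 1) = 0 :=
    fun j => by
      rw [Category.assoc, ← tower_d_snd, ← Category.assoc, hw, zero_comp]
  choose S' ρ' hρ' t₀ ht₀ using fun j =>
    D.exists_lift (D.tower K j) z (z + 1) (z + 1 + 1) rfl rfl _ (hwφ j)
  obtain ⟨T₂, π₂, _, l', hr⟩ := exists_epi_common_refinement hprodexact S' ρ' hρ'
  let t : ∀ j, T₂ ⟶ (D.tower K j).X z := fun j => l' j ≫ t₀ j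
  have ht : ∀ j, t j ≫ (D.tower K j).d z (z + 1) = π₂ ≫ w j ≫ D.towerFst K j _ := fun j => by
    rw [Category.assoc, ← ht₀, ← Category.assoc, hr]
  -- correct the `y j` to a compatible family
  let u : ∀ j, T₂ ⟶ (D.tower K j).X z := fun j =>
    Nat.rec 0 (fun j v => D.towerLift (v - t j) 0) j
  have hu : ∀ j, u (j + 1) ≫ D.towerFst K j z = u j - t j := fun j => D.towerLift_fst _ _ _
  let y' : ∀ j, T₂ ⟶ (D.tower K j).X (z + 1) := fun j =>
    π₂ ≫ y (j + 1) ≫ D.towerFst K j _ + u j ≫ (D.tower K j).d z (z + 1)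
  have hy'p : ∀ j, y' (j + 1) ≫ D.towerFst K j _ = y' j := fun j => by
    simp only [y', Preadditive.add_comp, Category.assoc, tower_d_fst]
    rw [← Category.assoc (u (j + 1)), hu, Preadditive.sub_comp, ht]
    simp only [w, Preadditive.sub_comp, Preadditive.comp_sub, Category.assoc]
    abel
  have hy'd : ∀ j, y' j ≫ (D.tower K j).d (z + 1) (z + 1 + 1) = (π₂ ≫ π₁) ≫ c j := fun j => by
    simp only [y', Preadditive.add_comp, Category.assoc, HomologicalComplex.d_comp_d, comp_zero,
      add_zero, ← tower_d_fst]
    rw [← Category.assoc (y _), hy, Category.assoc, hcp]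
  let e' : T₂ ⟶ ∏ᶜ fun j => D.obj (D.tower K j) (z + 1) :=
    Pi.lift fun j => y' (j + 1) ≫ D.towerSnd K j _
  have hy' : ∀ j, y' j = D.assemble (K := K) (y' 0) (fun j => e' ≫ Pi.π _ j) j :=
    D.eq_assemble rfl hy'p (fun j => by simp [e'])
  refine ⟨T₂, π₂ ≫ π₁, epi_comp _ _, y' 0, e', (hy'd 0).symm, Pi.hom_ext _ _ fun j => ?_⟩
  refine Eq.trans ?_ (D.toResolutionF_sub_resolutionD_π K _ e' j).symm
  calc
    ((π₂ ≫ π₁) ≫ e) ≫ Pi.π (fun j => D.obj (D.tower K j) (z + 1 + 1)) j =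
        ((π₂ ≫ π₁) ≫ c (j + 1)) ≫ D.towerSnd K j _ := by
      rw [Category.assoc, Category.assoc _ (c (j + 1)), assemble_succ_snd]
    _ = y' j ≫ D.φ (D.tower K j) (z + 1) (z + 1 + 1) := by
      rw [← hy'd, Category.assoc, tower_d_snd, ← Category.assoc, hy'p]
    _ = _ := by rw [← hy']

/-- The resolution is a quasi-isomorphism when countable products are exact. -/
lemma quasiIso_toResolution
    (hprodexact : ∀ (X Y : ℕ → C) (f : ∀ n, X n ⟶ Y n),
      (∀ n, Epi (f n)) → Epi (CategoryTheory.Limits.Pi.map f)) :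
    QuasiIso (D.toResolution K) where
  quasiIsoAt n := by
    obtain ⟨z, rfl⟩ : ∃ z, n = z + 1 + 1 := ⟨n - 2, by lia⟩
    rw [quasiIsoAt_iff_isIso_homologyMap]
    have : Mono (HomologicalComplex.homologyMap (D.toResolution K) (z + 1 + 1)) := by
      rw [HomologicalComplex.mono_homologyMap_iff_up_to_refinements _ (z + 1) _
        (z + 1 + 1 + 1) (by simp) (by simp)]
      intro T x _ e he
      obtain ⟨T', π, hπ, y, -, hy, -⟩ := D.toResolution_exact K hprodexact x e he
      exact ⟨T', π, hπ, y, hy⟩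
    have : Epi (HomologicalComplex.homologyMap (D.toResolution K) (z + 1 + 1)) := by
      rw [HomologicalComplex.epi_homologyMap_iff_up_to_refinements _ (z + 1) _
        (z + 1 + 1 + 1) (by simp) (by simp)]
      intro T e he
      obtain ⟨T', π, hπ, y, e', hy, h⟩ := D.toResolution_exact K hprodexact
        (0 : T ⟶ K.X (z + 1 + 1 + 1)) e (by rw [he, zero_comp])
      exact ⟨T', π, hπ, y, by rw [← hy, comp_zero], -e', by
        rw [h, Preadditive.neg_comp, sub_eq_add_neg]⟩
    exact isIso_of_mono_of_epi _

end CoboundaryDetector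

end

/-- Let `C` be an abelian category with exact countable products, and let `𝓑 ⊆ C` be
a cogenerating full subcategory closed under countable products.  Then every cochain
complex in `C` admits a quasi-isomorphism into a complex with all terms in `𝓑`. -/
theorem exists_quasiIso_into_complex_of_cogenerating_class
    (C : Type u) [Category.{v} C] [Abelian C] [HasCountableProducts C]
    -- countable products are exact:
    (hprodexact : ∀ (X Y : ℕ → C) (f : ∀ n, X n ⟶ Y n),
      (∀ n, Epi (f n)) → Epi (CategoryTheory.Limits.Pi.map f))
    (𝓑 : C → Prop)
    -- `𝓑` is cogenerating:
    (hcogen : ∀ X : C, ∃ (B : C) (ι : X ⟶ B), 𝓑 B ∧ Mono ι)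
    -- `𝓑` is closed under countable products:
    (hprod : ∀ X : ℕ → C, (∀ n, 𝓑 (X n)) → 𝓑 (∏ᶜ X))
    (K : CochainComplex C ℤ) :
    ∃ (L : CochainComplex C ℤ) (f : K ⟶ L),
      (∀ n : ℤ, 𝓑 (L.X n)) ∧ QuasiIso f := by
  obtain ⟨D, hD⟩ := exists_coboundaryDetector 𝓑 hcogen
  exact ⟨D.resolution K, D.toResolution K, fun n => hprod _ fun j => hD _ _,
    D.quasiIso_toResolution K hprodexact⟩
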